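/- Suppose the collection 𝒫_A^⊆ of potential-outcome distributions obeys distributional consistency and the family 𝒫_A = {p(V(a)) : a ∈ 𝔛_A} obeys the SWIG ordered local Markov property for the DAG 𝒢 under ≺. Then for every k ∈ V, every a ∈ 𝔛_A, and every assignment x to the variables X_1,…,X_k (the first k variables under ≺): p(X_1(a) = x_1,…,X_k(a) = x_k) = p(X_1(a_{pre(k)∩A}) = x_1,…,X_k(a_{pre(k)∩A}) = x_k), where a_{pre(k)∩A} denotes the intervention only on the targets in A ∩ pre(k) with the corresponding values from a. -/

import Mathlib

open Finset

namespace CausalPaper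

variable {V : Type*} [Fintype V] [LinearOrder V]
variable {𝔛 : V → Type*} [∀ i, Fintype (𝔛 i)]

/-- Probability of the event `E` under the distribution `q` on joint assignments. -/
noncomputable def pr (q : (∀ i, 𝔛 i) → ℝ) (E : (∀ i, 𝔛 i) → Prop) : ℝ :=
  ∑ v : (∀ i, 𝔛 i), Set.indicator (setOf E) q v

/-- Conditional probability of `E` given `F` under `q`. -/
noncomputable def cpr (q : (∀ i, 𝔛 i) → ℝ) (E F : (∀ i, 𝔛 i) → Prop) : ℝ :=
  pr q (fun v => E v ∧ F v) / pr q F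

/-- `q` is a probability distribution on joint assignments. -/
def IsProb (q : (∀ i, 𝔛 i) → ℝ) : Prop :=
  (∀ v, 0 ≤ q v) ∧ (∑ v : (∀ i, 𝔛 i), q v) = 1

/-- `v` agrees with `s` on the coordinates in `S`. -/
def agree (S : Finset V) (s v : ∀ i, 𝔛 i) : Prop :=
  ∀ i ∈ S, v i = s i

/-- The intervention/regime that sets the variables in `B` according to `b`
(and is idle elsewhere). -/
def setOn (B : Finset V) (b : ∀ i, 𝔛 i) : ∀ i, Option (𝔛 i) :=
  fun i => if i ∈ B then some (b i) else none

/-- The support of the partial intervention/regime `f` is contained in `A`. -/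
def suppIn (f : ∀ i, Option (𝔛 i)) (A : Finset V) : Prop :=
  ∀ i, f i ≠ none → i ∈ A

/-- Distributional consistency. -/
def DistConsistent (A : Finset V) (P : (∀ i, Option (𝔛 i)) → (∀ i, 𝔛 i) → ℝ) : Prop :=
  ∀ i ∈ A, ∀ C : Finset V, C ⊆ A \ {i} →
    ∀ (y : ∀ j, 𝔛 j) (b : 𝔛 i) (c : ∀ j, 𝔛 j),
      pr (P (Function.update (setOn C c) i (some b)))
          (fun v => agree (univ \ {i}) y v ∧ v i = b)
        = pr (P (setOn C c)) (fun v => agree (univ \ {i}) y v ∧ v i = b)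

/-- The predecessors of `i` under the total order on `V`. -/
def pre (i : V) : Finset V := univ.filter (fun j => j < i)

/-- The (SWIG / augmented-DAG) ordered local Markov property: under the regime
intervening on all of `A`, the conditional distribution of `X_i` given its
predecessors is a function only of `a` on `pa i ∩ A` and of `w` on `pa i \ A`. -/
def SWIGLocalMarkov (A : Finset V) (pa : V → Finset V)
    (P : (∀ i, Option (𝔛 i)) → (∀ i, 𝔛 i) → ℝ) : Prop :=
  ∀ (i : V) (a a' w w' : ∀ j, 𝔛 j) (x : 𝔛 i),
    0 < pr (P (setOn A a)) (agree (pre i) w) →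
    0 < pr (P (setOn A a')) (agree (pre i) w') →
    (∀ j ∈ pa i ∩ A, a j = a' j) →
    (∀ j ∈ pa i \ A, w j = w' j) →
    cpr (P (setOn A a)) (fun v => v i = x) (agree (pre i) w)
      = cpr (P (setOn A a')) (fun v => v i = x) (agree (pre i) w')

/-- The ordinary ordered local Markov property for a single distribution `q`:
the conditional distribution of `X_i` given its predecessors is a function only
of the values of the parents. -/
def OrderedLocalMarkov (pa : V → Finset V) (q : (∀ i, 𝔛 i) → ℝ) : Prop :=
  ∀ (i : V) (w w' : ∀ j, 𝔛 j) (x : 𝔛 i),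
    0 < pr q (agree (pre i) w) →
    0 < pr q (agree (pre i) w') →
    (∀ j ∈ pa i, w j = w' j) →
    cpr q (fun v => v i = x) (agree (pre i) w)
      = cpr q (fun v => v i = x) (agree (pre i) w')

lemma pr_eq_sum_ite (q : (∀ i, 𝔛 i) → ℝ) (E : (∀ i, 𝔛 i) → Prop) [DecidablePred E] :
    pr q E = ∑ v, if E v then q v else 0 := by
  refine Finset.sum_congr rfl fun v _ => ?_
  simp only [Set.indicator]
  congr 1

lemma pr_congr {q q' : (∀ i, 𝔛 i) → ℝ} {E : (∀ i, 𝔛 i) → Prop}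
    (h : ∀ v, E v → q v = q' v) : pr q E = pr q' E := by
  classical
  rw [pr_eq_sum_ite, pr_eq_sum_ite]
  refine Finset.sum_congr rfl fun v _ => ?_
  by_cases hv : E v <;> simp [hv, h]

lemma pr_mono {q : (∀ i, 𝔛 i) → ℝ} (hq : IsProb q) {E F : (∀ i, 𝔛 i) → Prop}
    (h : ∀ v, E v → F v) : pr q E ≤ pr q F :=
  Finset.sum_le_sum fun v _ => Set.indicator_le_indicator_of_subset h hq.1 v

lemma pr_nonneg {q : (∀ i, 𝔛 i) → ℝ} (hq : IsProb q) (E : (∀ i, 𝔛 i) → Prop) :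
    0 ≤ pr q E :=
  Finset.sum_nonneg fun v _ => Set.indicator_nonneg (fun v _ => hq.1 v) v

lemma pr_eq_singleton (q : (∀ i, 𝔛 i) → ℝ) {E : (∀ i, 𝔛 i) → Prop} {w : ∀ i, 𝔛 i}
    (h : ∀ v, E v ↔ v = w) : pr q E = q w := by
  classical
  simp [pr_eq_sum_ite, h]

/-- The law of total probability over the values of coordinate `i`. -/
lemma pr_eq_sum_and (q : (∀ i, 𝔛 i) → ℝ) (E : (∀ i, 𝔛 i) → Prop) (i : V) :
    pr q E = ∑ b, pr q (fun v => E v ∧ v i = b) := by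
  classical
  simp only [pr_eq_sum_ite]
  rw [Finset.sum_comm]
  refine Finset.sum_congr rfl fun v _ => ?_
  by_cases hv : E v <;> simp [hv]

/-- The marginal distribution on `S` determines the probability of every event about `S`. -/
lemma pr_eq_of_marginal_eq {q q' : (∀ i, 𝔛 i) → ℝ} {S : Finset V}
    (h : ∀ w, pr q (agree S w) = pr q' (agree S w)) {E : (∀ i, 𝔛 i) → Prop}
    (hE : DependsOn E (S : Set V)) : pr q E = pr q' E := by
  classical
  have fiber (p : (∀ i, 𝔛 i) → ℝ) (w : ∀ i, 𝔛 i) :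
      ∑ v with S.restrict v = S.restrict w, (if E v then p v else 0)
        = if E w then pr p (agree S w) else 0 := by
    have hagree (v : ∀ i, 𝔛 i) : S.restrict v = S.restrict w ↔ agree S w v := by
      simp [funext_iff, agree]
    simp only [hagree]
    have hEw : ∀ v, agree S w v → (E v ↔ E w) := fun v hv => iff_of_eq (hE hv)
    rw [Finset.sum_filter, pr_eq_sum_ite]
    split_ifs with hw
    · refine Finset.sum_congr rfl fun v _ => ?_
      by_cases hv : agree S w v <;> simp [hv, hEw, hw]
    · refine Finset.sum_eq_zero fun v _ => ?_
      by_cases hv : agree S w v <;> simp [hv, hEw, hw]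
  have key (p : (∀ i, 𝔛 i) → ℝ) :=
    Finset.sum_fiberwise_of_maps_to (s := univ) (t := univ.image (S.restrict (π := 𝔛)))
      (g := S.restrict) (fun v _ => Finset.mem_image_of_mem _ (Finset.mem_univ v))
      (fun v => if E v then p v else 0)
  rw [pr_eq_sum_ite, pr_eq_sum_ite, ← key q, ← key q']
  refine Finset.sum_congr rfl fun y hy => ?_
  obtain ⟨w, -, rfl⟩ := Finset.mem_image.mp hy
  rw [fiber, fiber, h]

lemma DistConsistent.apply_eq {A : Finset V}
    {P : (∀ i, Option (𝔛 i)) → (∀ i, 𝔛 i) → ℝ} (hDC : DistConsistent A P)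
    {i : V} (hi : i ∈ A) {C : Finset V} (hC : C ⊆ A \ {i}) (c v : ∀ j, 𝔛 j) :
    P (Function.update (setOn C c) i (some (v i))) v = P (setOn C c) v := by
  have hv : ∀ u : ∀ j, 𝔛 j, agree (univ \ {i}) v u ∧ u i = v i ↔ u = v := by
    refine fun u => ⟨fun ⟨h, hui⟩ => funext fun j => ?_, ?_⟩
    · by_cases hj : j = i
      · subst hj
        exact hui
      · exact h j (by simp [hj])
    · rintro rfl
      exact ⟨fun _ _ => rfl, rfl⟩
  have := hDC i hi C hC v (v i) c
  rwa [pr_eq_singleton _ hv, pr_eq_singleton _ hv] at this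

lemma isProb_setOn {A : Finset V} {P : (∀ i, Option (𝔛 i)) → (∀ i, 𝔛 i) → ℝ}
    (hP : ∀ f, suppIn f A → IsProb (P f)) (a : ∀ j, 𝔛 j) : IsProb (P (setOn A a)) :=
  hP _ fun i hi => by
    by_contra h
    exact hi (if_neg h)

lemma mem_pre {i j : V} : j ∈ pre i ↔ j < i := by
  simp [pre]

lemma pre_eq_insert_max' {n : V} (h : (pre n).Nonempty) :
    pre n = insert ((pre n).max' h) (pre ((pre n).max' h)) := by
  have hlt : (pre n).max' h < n := mem_pre.mp ((pre n).max'_mem h)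
  ext j
  rw [Finset.mem_insert, mem_pre, mem_pre, ← le_iff_eq_or_lt]
  exact ⟨fun hj => (pre n).le_max' j (mem_pre.mpr hj), fun hj => hj.trans_lt hlt⟩

/-- Under interventions on all targets, the distribution of the variables up to `n` does not
depend on the intervention values at `n` and later. -/
lemma pr_setOn_eq_of_eq_on_pre {A : Finset V} {pa : V → Finset V}
    (hpa : ∀ i, pa i ⊆ pre i) {P : (∀ i, Option (𝔛 i)) → (∀ i, 𝔛 i) → ℝ}
    (hP : ∀ f, suppIn f A → IsProb (P f)) (hM : SWIGLocalMarkov A pa P)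
    (n : V) (a a' w : ∀ j, 𝔛 j) (haa' : ∀ j < n, a j = a' j) :
    pr (P (setOn A a)) (agree (insert n (pre n)) w)
      = pr (P (setOn A a')) (agree (insert n (pre n)) w) := by
  induction n using WellFoundedLT.induction with
  | ind n ih =>
  have hpre : pr (P (setOn A a)) (agree (pre n) w) = pr (P (setOn A a')) (agree (pre n) w) := by
    rcases (pre n).eq_empty_or_nonempty with h | h
    · have htot (b : ∀ j, 𝔛 j) : pr (P (setOn A b)) (agree (pre n) w) = 1 := by
        classical
        simpa [pr_eq_sum_ite, h, agree] using (isProb_setOn hP b).2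
      rw [htot, htot]
    · have hlt : (pre n).max' h < n := mem_pre.mp ((pre n).max'_mem h)
      rw [pre_eq_insert_max' h]
      exact ih _ hlt fun j hj => haa' j (hj.trans hlt)
  have hsplit : agree (insert n (pre n)) w = fun v => v n = w n ∧ agree (pre n) w v := by
    ext v
    simp [agree]
  rcases (pr_nonneg (isProb_setOn hP a) (agree (pre n) w)).eq_or_lt with h0 | hpos
  · have hzero (b : ∀ j, 𝔛 j) (hb : pr (P (setOn A b)) (agree (pre n) w) = 0) :
        pr (P (setOn A b)) (agree (insert n (pre n)) w) = 0 :=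
      le_antisymm (hb ▸ pr_mono (isProb_setOn hP b)
        fun v hv j hj => hv j (Finset.mem_insert_of_mem hj)) (pr_nonneg (isProb_setOn hP b) _)
    rw [hzero a h0.symm, hzero a' (hpre ▸ h0.symm)]
  · have h := hM n a a' w w (w n) hpos (hpre ▸ hpos)
      (fun j hj => haa' j (mem_pre.mp (hpa n (Finset.mem_inter.mp hj).1)))
      fun _ _ => rfl
    rw [cpr, cpr, ← hpre, div_left_inj' hpos.ne'] at h
    rwa [hsplit]

/-- Dropping interventions on a set `s` of targets does not change the probability of an event
about variables that weakly precede all of `s`. -/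
lemma pr_setOn_sdiff {A : Finset V} {pa : V → Finset V}
    (hpa : ∀ i, pa i ⊆ pre i) {P : (∀ i, Option (𝔛 i)) → (∀ i, 𝔛 i) → ℝ}
    (hP : ∀ f, suppIn f A → IsProb (P f)) (hDC : DistConsistent A P)
    (hM : SWIGLocalMarkov A pa P) (s : Finset V) (hs : s ⊆ A) (a : ∀ j, 𝔛 j)
    {S : Finset V} {E : (∀ j, 𝔛 j) → Prop} (hE : DependsOn E (S : Set V))
    (hS : ∀ i ∈ s, ∀ j ∈ S, j ≤ i) :
    pr (P (setOn A a)) E = pr (P (setOn (A \ s) a)) E := by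
  induction s using Finset.induction_on_min generalizing a S E with
  | empty => simp
  | insert i s hi ih =>
    have hiA : i ∈ A := hs (Finset.mem_insert_self i s)
    have his : i ∉ s := fun h => lt_irrefl i (hi i h)
    rw [pr_eq_sum_and _ E i, pr_eq_sum_and _ E i]
    refine Finset.sum_congr rfl fun b _ => ?_
    have hEb : DependsOn (fun v : ∀ j, 𝔛 j => E v ∧ v i = b)
        ((insert i S : Finset V) : Set V) := by
      intro u v huv
      have h1 : E u = E v := hE fun j hj => huv j (by simp [Finset.mem_coe.mp hj])
      have h2 : u i = v i := huv i (by simp)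
      simp only [h1, h2]
    have hup : setOn (A \ s) (Function.update a i b)
        = Function.update (setOn (A \ insert i s) a) i (some b) := by
      funext j
      by_cases hj : j = i
      · subst hj
        simp [setOn, hiA, his]
      · simp [setOn, hj]
    have hsub : A \ insert i s ⊆ A \ {i} :=
      Finset.sdiff_subset_sdiff le_rfl (by simp)
    calc pr (P (setOn A a)) (fun v => E v ∧ v i = b)
        = pr (P (setOn A (Function.update a i b))) (fun v => E v ∧ v i = b) := by
          refine pr_eq_of_marginal_eq (S := insert i (pre i)) (fun w => ?_) fun u v huv =>
            hEb fun j hj => huv j ?_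
          · exact pr_setOn_eq_of_eq_on_pre hpa hP hM i _ _ w fun j hj => by simp [hj.ne]
          · rcases Finset.mem_insert.mp (Finset.mem_coe.mp hj) with rfl | hj
            · simp
            · simpa [mem_pre] using (hS i (Finset.mem_insert_self i s) j hj).eq_or_lt
      _ = pr (P (setOn (A \ s) (Function.update a i b))) (fun v => E v ∧ v i = b) := by
          refine ih (fun j hj => hs (Finset.mem_insert_of_mem hj)) _ hEb fun l hl j hj => ?_
          rcases Finset.mem_insert.mp hj with rfl | hj
          · exact (hi l hl).le
          · exact hS l (Finset.mem_insert_of_mem hl) j hj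
      _ = pr (P (setOn (A \ insert i s) a)) (fun v => E v ∧ v i = b) := by
          rw [hup]
          refine pr_congr fun v hv => ?_
          obtain ⟨-, rfl⟩ := hv
          exact hDC.apply_eq hiA hsub a v

/-- Lemma 5: interventions in the future have no effect on the joint distribution
of the variables up to and including `k`. -/
theorem stmt4_no_effect_of_future_interventions
    (A : Finset V) (hA : A ⊆ univ)
    (pa : V → Finset V) (hpa : ∀ i, pa i ⊆ pre i)
    (P : (∀ i, Option (𝔛 i)) → (∀ i, 𝔛 i) → ℝ)
    (hP : ∀ f, suppIn f A → IsProb (P f))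
    (hDC : DistConsistent A P)
    (hM : SWIGLocalMarkov A pa P)
    (k : V) (a x : ∀ j, 𝔛 j) :
    pr (P (setOn A a)) (agree (insert k (pre k)) x)
      = pr (P (setOn (pre k ∩ A) a)) (agree (insert k (pre k)) x) := by
  have hset : pre k ∩ A = A \ (A \ pre k) := by
    ext j
    simp [and_comm]
  rw [hset]
  refine pr_setOn_sdiff hpa hP hDC hM _ Finset.sdiff_subset a
    (S := insert k (pre k)) (fun u v huv => ?_) fun i hi j hj => ?_
  · exact propext (forall₂_congr fun j hj => by rw [huv j hj])
  · have hki : k ≤ i := not_lt.mp (mt mem_pre.mpr (Finset.mem_sdiff.mp hi).2)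
    rcases Finset.mem_insert.mp hj with rfl | hj
    · exact hki
    · exact (mem_pre.mp hj).le.trans hki

end CausalPaper
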